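/- arXiv:1704.03195 — 3 statements merged into one kernel-verified Lean document; each statement's English description precedes it below -/
import Mathlib

section
/- Triviality of unconstrained minimizers: let r > 0 and let E ⊆ ℝⁿ be a measurable set such that for every open ball B ⊆ ℝⁿ and every measurable F ⊆ ℝⁿ with F \ B = E \ B one has Per_r(E, B) ≤ Per_r(F, B). Then either Lⁿ(E) = 0 or Lⁿ(ℝⁿ \ E) = 0. -/
open MeasureTheory Metric Set Filter Topology
open scoped RealInnerProductSpace ENNReal

noncomputable section

/-- The set of points of Lebesgue density one of `E`. -/
def densityOnePoints (n : ℕ) (E : Set (EuclideanSpace ℝ (Fin n))) :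
    Set (EuclideanSpace ℝ (Fin n)) :=
  {x | Tendsto (fun ρ : ℝ => volume (E ∩ ball x ρ) / volume (ball x ρ)) (𝓝[>] 0) (𝓝 1)}

/-- The `r`-perimeter `Per_r(E, Ω) = (1/(2r)) Lⁿ((∂E ⊕ B_r) ∩ Ω)`, where `E` is identified with
its points of density one, `∂E` is the topological boundary of that set, and
`A ⊕ B_r` is the open `r`-neighbourhood of `A`. -/
def perR (n : ℕ) (r : ℝ) (E Ω : Set (EuclideanSpace ℝ (Fin n))) : ℝ≥0∞ :=
  volume (Metric.thickening r (frontier (densityOnePoints n E)) ∩ Ω) / ENNReal.ofReal (2 * r)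


lemma dens_mono {n : ℕ} {E F : Set (EuclideanSpace ℝ (Fin n))} (h : E ⊆ F) :
    densityOnePoints n E ⊆ densityOnePoints n F := by
  intro x hx
  refine tendsto_of_tendsto_of_tendsto_of_le_of_le hx tendsto_const_nhds ?_ ?_
  · intro ρ
    exact ENNReal.div_le_div_right (measure_mono (inter_subset_inter_left _ h)) _
  · intro ρ
    exact (ENNReal.div_le_div_right (measure_mono inter_subset_right) _).trans ENNReal.div_self_le_one

lemma eventually_ball_sub {n : ℕ} {x p : EuclideanSpace ℝ (Fin n)} {t : ℝ} (hx : x ∈ ball p t) :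
    ∀ᶠ ρ : ℝ in 𝓝[>] 0, 0 < ρ ∧ ball x ρ ⊆ ball p t := by
  obtain ⟨ε, hε, h⟩ := Metric.isOpen_iff.1 isOpen_ball x hx
  filter_upwards [Ioo_mem_nhdsGT hε] with ρ hρ
  exact ⟨hρ.1, (ball_subset_ball hρ.2.le).trans h⟩

lemma dens_diff {n : ℕ} (E : Set (EuclideanSpace ℝ (Fin n))) (p : EuclideanSpace ℝ (Fin n))
    (t : ℝ) : Disjoint (ball p t) (densityOnePoints n (E \ ball p t)) := by
  rw [Set.disjoint_left]
  intro x hx hD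
  have h0 : Tendsto (fun ρ : ℝ => volume ((E \ ball p t) ∩ ball x ρ) / volume (ball x ρ))
      (𝓝[>] 0) (𝓝 0) := by
    refine tendsto_const_nhds.congr' ?_
    filter_upwards [eventually_ball_sub hx] with ρ hρ
    have : (E \ ball p t) ∩ ball x ρ = ∅ := by
      ext y
      simp only [mem_inter_iff, Set.mem_sdiff, mem_empty_iff_false, iff_false]
      rintro ⟨⟨_, h1⟩, h2⟩
      exact h1 (hρ.2 h2)
    rw [this]; simp
  exact zero_ne_one (tendsto_nhds_unique h0 hD)

lemma dens_union {n : ℕ} (E : Set (EuclideanSpace ℝ (Fin n))) (p : EuclideanSpace ℝ (Fin n))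
    (t : ℝ) : ball p t ⊆ densityOnePoints n (E ∪ ball p t) := by
  intro x hx
  refine tendsto_const_nhds.congr' ?_
  filter_upwards [eventually_ball_sub hx] with ρ hρ
  have : (E ∪ ball p t) ∩ ball x ρ = ball x ρ := by
    apply inter_eq_right.2
    exact hρ.2.trans subset_union_right
  rw [this, ENNReal.div_self (measure_ball_pos _ _ hρ.1).ne' measure_ball_lt_top.ne]

lemma preconn_frontier {n : ℕ} {S D : Set (EuclideanSpace ℝ (Fin n))} (hS : IsPreconnected S)
    (h1 : (S ∩ D).Nonempty) (h2 : (S ∩ Dᶜ).Nonempty) : (S ∩ frontier D).Nonempty := by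
  by_contra hc
  have hc' : ∀ x ∈ S, x ∉ frontier D := fun x hx hf => hc ⟨x, hx, hf⟩
  have hi : ∀ x ∈ S, x ∈ D → x ∈ interior D := fun x hx hD => by
    by_contra h
    exact hc' x hx ⟨subset_closure hD, h⟩
  have he : ∀ x ∈ S, x ∉ D → x ∈ (closure D)ᶜ := fun x hx hD h =>
    hc' x hx ⟨h, fun h' => hD (interior_subset h')⟩
  obtain ⟨a, ha, haD⟩ := h1
  obtain ⟨b, hb, hbD⟩ := h2
  obtain ⟨c, _, hc1, hc2⟩ := hS (interior D) (closure D)ᶜ isOpen_interior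
    isClosed_closure.isOpen_compl
    (fun x hx => by
      by_cases h : x ∈ D
      · exact Or.inl (hi x hx h)
      · exact Or.inr (he x hx h)) ⟨a, ha, hi a ha haD⟩ ⟨b, hb, he b hb hbD⟩
  exact hc2 (subset_closure (interior_subset hc1))

lemma seg_frontier {n : ℕ} {D : Set (EuclideanSpace ℝ (Fin n))} {r : ℝ}
    {z x a b : EuclideanSpace ℝ (Fin n)} (hzx : dist z x < r)
    (h : (a = z ∧ b = x) ∨ (a = x ∧ b = z)) (ha : a ∈ D) (hb : b ∉ D) :
    z ∈ thickening r (frontier D) := by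
  have hz : z ∈ segment ℝ z x := left_mem_segment ℝ z x
  have hx : x ∈ segment ℝ z x := right_mem_segment ℝ z x
  have h1 : (segment ℝ z x ∩ D).Nonempty := by
    rcases h with ⟨rfl, rfl⟩ | ⟨rfl, rfl⟩
    · exact ⟨_, hz, ha⟩
    · exact ⟨_, hx, ha⟩
  have h2 : (segment ℝ z x ∩ Dᶜ).Nonempty := by
    rcases h with ⟨rfl, rfl⟩ | ⟨rfl, rfl⟩
    · exact ⟨_, hx, hb⟩
    · exact ⟨_, hz, hb⟩
  obtain ⟨k, hk, hkD⟩ := preconn_frontier (convex_segment z x).isPreconnected h1 h2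
  rw [mem_thickening_iff]
  refine ⟨k, hkD, lt_of_le_of_lt ?_ hzx⟩
  have := dist_add_dist_of_mem_segment hk
  linarith [dist_nonneg (x := k) (y := x)]

lemma strict {n : ℕ} {D D' : Set (EuclideanSpace ℝ (Fin n))} {r s : ℝ} (hs : 0 < s) (hr : 0 < r)
    {p : EuclideanSpace ℝ (Fin n)}
    (hdis : Disjoint (ball p (r + s)) (frontier D'))
    (hsub : thickening r (frontier D') ∩ ball p (r + s) ⊆ thickening r (frontier D))
    (hne : (thickening r (frontier D) ∩ ball p s).Nonempty) :
    volume (thickening r (frontier D') ∩ ball p (r + s)) <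
      volume (thickening r (frontier D) ∩ ball p (r + s)) := by
  have hG : IsOpen (thickening r (frontier D) ∩ ball p s) := isOpen_thickening.inter isOpen_ball
  have hpos := hG.measure_pos volume hne
  have hfin : volume (thickening r (frontier D') ∩ ball p (r + s)) ≠ ∞ :=
    ((measure_mono inter_subset_right).trans_lt measure_ball_lt_top).ne
  have hd : Disjoint (thickening r (frontier D') ∩ ball p (r + s))
      (thickening r (frontier D) ∩ ball p s) := by
    rw [Set.disjoint_left]
    rintro z ⟨hz, _⟩ ⟨_, hzs⟩
    obtain ⟨k, hk, hzk⟩ := mem_thickening_iff.1 hz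
    refine Set.disjoint_left.1 hdis ?_ hk
    rw [mem_ball] at *
    have := dist_triangle_left k p z
    linarith
  calc _ < volume (thickening r (frontier D') ∩ ball p (r + s)) +
        volume (thickening r (frontier D) ∩ ball p s) := ENNReal.lt_add_right hfin hpos.ne'
    _ = volume ((thickening r (frontier D') ∩ ball p (r + s)) ∪
        (thickening r (frontier D) ∩ ball p s)) := (measure_union hd hG.measurableSet).symm
    _ ≤ _ := by
      apply measure_mono
      apply union_subset
      · exact subset_inter hsub inter_subset_right
      · exact inter_subset_inter_right _ (ball_subset_ball (by linarith))

lemma near_pt {n : ℕ} {z p : EuclideanSpace ℝ (Fin n)} {a b : ℝ} (ha : 0 < a) (hb : 0 < b)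
    (h : dist z p < a + b) : ∃ w, dist z w < a ∧ w ∈ ball p b := by
  have : z ∈ thickening a (ball p b) := by
    rw [thickening_ball ha hb]; simpa [mem_ball] using h
  obtain ⟨w, hw, h1⟩ := mem_thickening_iff.1 this
  exact ⟨w, h1, hw⟩

lemma sub_diff {n : ℕ} {D D' : Set (EuclideanSpace ℝ (Fin n))} {r s R : ℝ} (hr : 0 < r)
    (hR : 0 < R) (hsR : s < R) {p : EuclideanSpace ℝ (Fin n)}
    (h1 : D' ⊆ D) (h3 : Disjoint (ball p R) D) :
    thickening r (frontier D') ∩ ball p (r + s) ⊆ thickening r (frontier D) := by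
  rintro z ⟨hz, hzB⟩
  obtain ⟨x, hx, hzx⟩ := mem_thickening_iff.1 hz
  by_cases hxi : x ∈ interior D
  · by_cases hzD : z ∈ D
    · obtain ⟨w, hw, hwp⟩ := near_pt (z := z) (p := p) hr hR (by rw [mem_ball] at hzB; linarith)
      exact seg_frontier hw (Or.inl ⟨rfl, rfl⟩) hzD (Set.disjoint_left.1 h3 hwp)
    · exact seg_frontier hzx (Or.inr ⟨rfl, rfl⟩) (interior_subset hxi) hzD
  · exact mem_thickening_iff.2 ⟨x, ⟨closure_mono h1 hx.1, hxi⟩, hzx⟩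

lemma sub_union {n : ℕ} {D D' : Set (EuclideanSpace ℝ (Fin n))} {r s R : ℝ} (hr : 0 < r)
    (hR : 0 < R) (hsR : s < R) {p : EuclideanSpace ℝ (Fin n)}
    (h1 : D ⊆ D') (h3 : ball p R ⊆ D) :
    thickening r (frontier D') ∩ ball p (r + s) ⊆ thickening r (frontier D) := by
  have := sub_diff (D := Dᶜ) (D' := D'ᶜ) hr hR hsR (p := p) (compl_subset_compl.2 h1)
    (Set.disjoint_left.2 fun x hx hc => hc (h3 hx))
  simpa only [frontier_compl] using this

lemma dis_diff {n : ℕ} {D : Set (EuclideanSpace ℝ (Fin n))} {t : ℝ}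
    {p : EuclideanSpace ℝ (Fin n)} (h : Disjoint (ball p t) D) :
    Disjoint (ball p t) (frontier D) :=
  (h.closure_right isOpen_ball).mono_right frontier_subset_closure

lemma dis_union {n : ℕ} {D : Set (EuclideanSpace ℝ (Fin n))} {t : ℝ}
    {p : EuclideanSpace ℝ (Fin n)} (h : ball p t ⊆ D) :
    Disjoint (ball p t) (frontier D) := by
  rw [← frontier_compl]
  exact dis_diff (Set.disjoint_left.2 fun x hx hc => hc (h hx))

lemma perR_lt {n : ℕ} {r : ℝ} (hr : 0 < r) {E F B : Set (EuclideanSpace ℝ (Fin n))}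
    (h : volume (thickening r (frontier (densityOnePoints n F)) ∩ B) <
      volume (thickening r (frontier (densityOnePoints n E)) ∩ B)) :
    ¬ perR n r E B ≤ perR n r F B := by
  rw [not_le]
  unfold perR
  exact ENNReal.div_lt_div_right (by simpa using hr) ENNReal.ofReal_ne_top h

lemma ae_dens {n : ℕ} {E : Set (EuclideanSpace ℝ (Fin n))} (hE : MeasurableSet E) :
    ∀ᵐ x, (x ∈ densityOnePoints n E ↔ x ∈ E) := by
  filter_upwards [Besicovitch.ae_tendsto_measure_inter_div_of_measurableSet volume hE] with x hx
  have key : Tendsto (fun ρ : ℝ => volume (E ∩ ball x ρ) / volume (ball x ρ)) (𝓝[>] 0)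
      (𝓝 (E.indicator 1 x)) := by
    refine hx.congr' ?_
    filter_upwards [self_mem_nhdsWithin] with ρ hρ
    have hae : (closedBall x ρ : Set _) =ᵐ[volume] ball x ρ := by
      symm
      refine ae_eq_of_subset_of_measure_ge ball_subset_closedBall ?_
        measurableSet_ball.nullMeasurableSet measure_closedBall_lt_top.ne
      rw [Measure.addHaar_closedBall _ _ (le_of_lt hρ), Measure.addHaar_ball_of_pos _ _ hρ]
    rw [measure_congr hae, measure_congr ((ae_eq_refl E).inter hae)]
  constructor
  · intro hD
    by_contra hxE
    rw [indicator_of_notMem hxE] at key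
    exact zero_ne_one (tendsto_nhds_unique key hD)
  · intro hxE
    rw [indicator_of_mem hxE] at key
    exact key

/-- Triviality of unconstrained minimizers: if `E` minimizes `Per_r(·, B)` in every open ball `B`
among competitors allowed to modify `E` up to the boundary of `B`, then `E` has either null
measure or null complement. -/
theorem trivial_unconstrained_minimizers (n : ℕ) (r : ℝ) (hr : 0 < r)
    (E : Set (EuclideanSpace ℝ (Fin n))) (hE : MeasurableSet E)
    (hmin : ∀ (x : EuclideanSpace ℝ (Fin n)) (ρ : ℝ), 0 < ρ →
      ∀ F : Set (EuclideanSpace ℝ (Fin n)), MeasurableSet F →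
        F \ ball x ρ = E \ ball x ρ →
        perR n r E (ball x ρ) ≤ perR n r F (ball x ρ)) :
    volume E = 0 ∨ volume Eᶜ = 0 := by
  set D := densityOnePoints n E with hD
  have hK : frontier D = ∅ := by
    by_contra hne
    have hne : (frontier D).Nonempty := nonempty_iff_ne_empty.2 hne
    by_cases huniv : frontier D = univ
    · refine perR_lt (E := E) hr ?_ (hmin 0 (r + r) (by linarith) (E \ ball 0 (r + r))
        (hE.diff measurableSet_ball) (by simp))
      have hT : thickening r (frontier D) = univ :=
        univ_subset_iff.1 (huniv ▸ self_subset_thickening hr (frontier D))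
      refine strict hr hr (dis_diff (dens_diff _ _ _)) ?_ ?_
      · rw [← hD, hT]; exact subset_univ _
      · rw [← hD, hT]; exact ⟨0, trivial, mem_ball_self hr⟩
    · obtain ⟨p, hp⟩ := (ne_univ_iff_exists_notMem _).1 huniv
      obtain ⟨y, hy, hyd⟩ := isClosed_frontier.exists_infDist_eq_dist hne p
      set R := infDist p (frontier D) with hRdef
      have hR : 0 < R := (isClosed_frontier.notMem_iff_infDist_pos hne).1 hp
      have hball : Disjoint (ball p R) (frontier D) := disjoint_ball_infDist
      obtain ⟨s, hs, hsR, hrs⟩ : ∃ s, 0 < s ∧ s < R ∧ R < r + s :=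
        ⟨max (R / 2) (R - r / 2), lt_max_of_lt_left (by linarith),
          max_lt (by linarith) (by linarith), by linarith [le_max_right (R / 2) (R - r / 2)]⟩
      have hN : (thickening r (frontier D) ∩ ball p s).Nonempty := by
        obtain ⟨w, hw, hwp⟩ := near_pt (z := y) (p := p) hr hs (by rw [dist_comm]; linarith)
        exact ⟨w, mem_thickening_iff.2 ⟨y, hy, by rwa [dist_comm]⟩, hwp⟩
      by_cases hsub : ball p R ⊆ D
      · refine perR_lt (E := E) hr ?_ (hmin p (r + s) (by linarith) (E ∪ ball p (r + s))
          (hE.union measurableSet_ball) (by simp))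
        exact strict hs hr (dis_union (dens_union _ _ _))
          (sub_union hr hR hsR (dens_mono subset_union_left) hsub) hN
      · have hdis : Disjoint (ball p R) D := by
          rw [Set.disjoint_left]
          intro x hx hxD
          obtain ⟨w, hw, hwD⟩ := not_subset.1 hsub
          obtain ⟨k, hk, hkD⟩ := preconn_frontier (convex_ball p R).isPreconnected
            ⟨x, hx, hxD⟩ ⟨w, hw, hwD⟩
          exact Set.disjoint_left.1 hball hk hkD
        refine perR_lt (E := E) hr ?_ (hmin p (r + s) (by linarith) (E \ ball p (r + s))
          (hE.diff measurableSet_ball) (by simp))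
        exact strict hs hr (dis_diff (dens_diff _ _ _))
          (sub_diff hr hR hsR (dens_mono sdiff_subset) hdis) hN
  have hclopen : IsClopen D := isClopen_iff_frontier_eq_empty.2 hK
  rcases isClopen_iff.1 hclopen with h | h
  · left
    rw [measure_eq_zero_iff_ae_notMem]
    filter_upwards [ae_dens hE] with x hx hxE
    have := hx.2 hxE
    rw [← hD, h] at this
    exact this
  · right
    rw [measure_eq_zero_iff_ae_notMem]
    filter_upwards [ae_dens hE] with x hx hxE
    refine hxE (hx.1 ?_)
    rw [← hD, h]; trivial
end
end

section
/- Isoperimetric inequality for the r-perimeter: for every n ≥ 1, R > 0, r > 0 and every measurable set E ⊆ ℝⁿ with Lⁿ(E) = Lⁿ(B_R), one has Per_r(E) ≥ Per_r(B_R), where B_R denotes the open ball of radius R centered at the origin. -/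
open MeasureTheory Metric Set Filter Topology
open scoped RealInnerProductSpace ENNReal

noncomputable section

lemma bm_compact {K L : Set ℝ} (hK : IsCompact K) (hL : IsCompact L) (hKn : K.Nonempty)
    (hLn : L.Nonempty) {C : Set ℝ} (hC : ∀ x ∈ K, ∀ y ∈ L, x + y ∈ C) :
    volume K + volume L ≤ volume C := by
  obtain ⟨b, hbL, hb⟩ := hL.exists_isLeast hLn
  obtain ⟨a, haK, ha⟩ := hK.exists_isGreatest hKn
  have h1 : volume ((fun x => x + (-b)) ⁻¹' K) = volume K := measure_preimage_add_right _ _ _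
  have h2 : volume ((fun x => (-a) + x) ⁻¹' L) = volume L := measure_preimage_add _ _ _
  rw [← h1, ← h2]
  have hm : MeasurableSet ((fun x => (-a) + x) ⁻¹' L) :=
    hL.measurableSet.preimage (by fun_prop)
  rw [← measure_union_add_inter _ hm]
  have h3 : volume (((fun x => x + (-b)) ⁻¹' K) ∩ ((fun x => (-a) + x) ⁻¹' L)) = 0 := by
    apply measure_mono_null (t := {a + b}) _ (by simp)
    rintro x ⟨hx1, hx2⟩
    have := ha hx1
    have := hb hx2
    simp only [mem_singleton_iff]
    linarith
  rw [h3, add_zero]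
  apply measure_mono
  rintro x (hx | hx)
  · have := hC _ hx _ hbL
    simpa using this
  · have := hC _ haK _ hx
    simpa using this

lemma bm_real {A B C : Set ℝ} (hA : MeasurableSet A) (hB : MeasurableSet B) (hAn : A.Nonempty)
    (hBn : B.Nonempty) (hC : ∀ x ∈ A, ∀ y ∈ B, x + y ∈ C) :
    volume A + volume B ≤ volume C := by
  obtain ⟨a, ha⟩ := hAn
  obtain ⟨b, hb⟩ := hBn
  rw [hA.measure_eq_iSup_isCompact, hB.measure_eq_iSup_isCompact]
  simp only [iSup_and']
  apply ENNReal.biSup_add_biSup_le' ⟨∅, by simp⟩ ⟨∅, by simp⟩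
  rintro K ⟨hK, hKc⟩ L ⟨hL, hLc⟩
  refine le_trans (add_le_add (measure_mono (subset_insert a K))
    (measure_mono (subset_insert b L))) ?_
  refine bm_compact (hKc.insert a) (hLc.insert b) (by simp) (by simp) ?_
  intro x hx y hy
  exact hC x (insert_subset ha hK hx) y (insert_subset hb hL hy)

lemma bm_weighted {p q : ℝ} (hp : 0 < p) (hq : 0 < q)
    {A B C : Set ℝ} (hA : MeasurableSet A) (hB : MeasurableSet B) (hAn : A.Nonempty)
    (hBn : B.Nonempty) (hC : ∀ x ∈ A, ∀ y ∈ B, p * x + q * y ∈ C) :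
    ENNReal.ofReal p * volume A + ENNReal.ofReal q * volume B ≤ volume C := by
  have h := bm_real (A := (fun x => p⁻¹ • x) ⁻¹' A) (B := (fun x => q⁻¹ • x) ⁻¹' B) (C := C)
    (hA.preimage (by fun_prop)) (hB.preimage (by fun_prop)) ?_ ?_ ?_
  · rw [Measure.addHaar_preimage_smul _ (by positivity),
      Measure.addHaar_preimage_smul _ (by positivity)] at h
    simpa [abs_of_pos hp, abs_of_pos hq] using h
  · obtain ⟨a, ha⟩ := hAn
    exact ⟨p * a, by simpa [hp.ne'] using ha⟩
  · obtain ⟨a, ha⟩ := hBn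
    exact ⟨q * a, by simpa [hq.ne'] using ha⟩
  · intro x hx y hy
    have := hC _ hx _ hy
    simpa [← mul_assoc, hp.ne', hq.ne'] using this

lemma pl_core {p q : ℝ} (hp : 0 < p) (hq : 0 < q) {f g h : ℝ → ℝ} (hf : Measurable f)
    (hg : Measurable g) (hh : Measurable h) (hf0 : ∀ x, 0 ≤ f x) (hg0 : ∀ x, 0 ≤ g x)
    (hh0 : ∀ x, 0 ≤ h x) (hf1 : ∀ x, f x ≤ 1) (hg1 : ∀ x, g x ≤ 1)
    (hfs : ∀ c < 1, ∃ x, c < f x) (hgs : ∀ c < 1, ∃ x, c < g x)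
    (H : ∀ c > 0, ∀ x y, c < f x → c < g y → c < h (p * x + q * y)) :
    ENNReal.ofReal p * (∫⁻ x, ENNReal.ofReal (f x)) + ENNReal.ofReal q * (∫⁻ x, ENNReal.ofReal (g x))
      ≤ ∫⁻ x, ENNReal.ofReal (h x) := by
  rw [lintegral_eq_lintegral_meas_lt _ (ae_of_all _ hf0) hf.aemeasurable,
    lintegral_eq_lintegral_meas_lt _ (ae_of_all _ hg0) hg.aemeasurable,
    lintegral_eq_lintegral_meas_lt _ (ae_of_all _ hh0) hh.aemeasurable]
  have hmono : ∀ k : ℝ → ℝ, Measurable (fun t => volume {a | t < k a}) := by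
    intro k
    apply Antitone.measurable
    intro s t hst
    apply measure_mono
    intro a ha
    exact lt_of_le_of_lt hst ha
  rw [← lintegral_const_mul _ (hmono f), ← lintegral_const_mul _ (hmono g),
    ← lintegral_add_left ((hmono f).const_mul _)]
  apply setLIntegral_mono (hmono h)
  intro c hc
  by_cases hc1 : c < 1
  · exact bm_weighted hp hq (measurableSet_lt measurable_const hf)
      (measurableSet_lt measurable_const hg) (hfs c hc1) (hgs c hc1)
      (fun x hx y hy => H c hc x y hx hy)
  · have e1 : {a | c < f a} = ∅ := by
      ext x; simp; linarith [hf1 x]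
    have e2 : {a | c < g a} = ∅ := by
      ext x; simp; linarith [hg1 x]
    simp [e1, e2]

lemma amgm {p q : ℝ} (hp : 0 < p) (hq : 0 < q) (hpq : p + q = 1) (a b : ℝ≥0∞) :
    a ^ p * b ^ q ≤ ENNReal.ofReal p * a + ENNReal.ofReal q * b := by
  have hc : (p⁻¹).HolderConjugate q⁻¹ := by
    rw [Real.holderConjugate_iff]
    refine ⟨?_, by simpa using hpq⟩
    rw [one_lt_inv₀ hp]; linarith
  have := ENNReal.young_inequality (a ^ p) (b ^ q) hc
  rw [← ENNReal.rpow_mul, ← ENNReal.rpow_mul, mul_inv_cancel₀ hp.ne', mul_inv_cancel₀ hq.ne',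
    ENNReal.ofReal_inv_of_pos hp, ENNReal.ofReal_inv_of_pos hq] at this
  simpa [div_eq_mul_inv, mul_comm] using this

lemma pl_bdd {p q : ℝ} (hp : 0 < p) (hq : 0 < q) (hpq : p + q = 1) {f g h : ℝ → ℝ≥0∞}
    (hf : Measurable f) (hg : Measurable g) (hh : Measurable h)
    (hfb : ⨆ x, f x ≠ ∞) (hgb : ⨆ x, g x ≠ ∞)
    (H : ∀ x y, f x ^ p * g y ^ q ≤ h (p * x + q * y)) :
    (∫⁻ x, f x) ^ p * (∫⁻ x, g x) ^ q ≤ ∫⁻ x, h x := by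
  set S := ⨆ x, f x with hS
  set T := ⨆ x, g x with hT
  have hfS : ∀ x, f x ≤ S := fun x => le_iSup f x
  have hgT : ∀ x, g x ≤ T := fun x => le_iSup g x
  by_cases hS0 : S = 0
  · have : ∀ x, f x = 0 := fun x => by simpa [hS0] using hfS x
    simp [this, hp]
  by_cases hT0 : T = 0
  · have : ∀ x, g x = 0 := fun x => by simpa [hT0] using hgT x
    simp [this, hq]
  set c : ℝ≥0∞ := S ^ p * T ^ q with hc
  have hSp0 : S ^ p ≠ 0 := by simp [hS0, hfb]
  have hTq0 : T ^ q ≠ 0 := by simp [hT0, hgb]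
  have hSp : S ^ p ≠ ∞ := ENNReal.rpow_ne_top_of_nonneg hp.le hfb
  have hTq : T ^ q ≠ ∞ := ENNReal.rpow_ne_top_of_nonneg hq.le hgb
  have hc0 : c ≠ 0 := mul_ne_zero hSp0 hTq0
  have hct : c ≠ ∞ := ENNReal.mul_ne_top hSp hTq
  have f1 : ∀ x, f x / S ≤ 1 := fun x => ENNReal.div_le_of_le_mul (by simpa using hfS x)
  have g1 : ∀ x, g x / T ≤ 1 := fun x => ENNReal.div_le_of_le_mul (by simpa using hgT x)
  have sup : ∀ k : ℝ → ℝ≥0∞, ∀ S, S = ⨆ x, k x → S ≠ 0 → S ≠ ∞ → (∀ x, k x / S ≤ 1) →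
      ∀ c < 1, ∃ x, c < (k x / S).toReal := by
    intro k S hS h0 ht h1 c hc
    by_cases hc0 : c < 0
    · exact ⟨0, hc0.trans_le ENNReal.toReal_nonneg⟩
    push Not at hc0
    have : ENNReal.ofReal c * S < ⨆ x, k x := by
      rw [← hS]
      calc _ < 1 * S := by
            rw [ENNReal.mul_lt_mul_iff_left h0 ht]; simpa using hc
        _ = S := one_mul _
    obtain ⟨x, hx⟩ := lt_iSup_iff.1 this
    refine ⟨x, ?_⟩
    rw [← ENNReal.ofReal_lt_iff_lt_toReal hc0 (ne_top_of_le_ne_top (by simp) (h1 x))]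
    rwa [ENNReal.lt_div_iff_mul_lt (Or.inl h0) (Or.inl ht)]
  have key := pl_core hp hq (f := fun x => (f x / S).toReal) (g := fun x => (g x / T).toReal)
    (h := fun x => (min (h x / c) 1).toReal) (by fun_prop) (by fun_prop) (by fun_prop)
    (fun x => ENNReal.toReal_nonneg) (fun x => ENNReal.toReal_nonneg) (fun x => ENNReal.toReal_nonneg)
    (fun x => ENNReal.toReal_le_of_le_ofReal (by simp) (by simpa using f1 x))
    (fun x => ENNReal.toReal_le_of_le_ofReal (by simp) (by simpa using g1 x))
    (sup f S hS hS0 hfb f1) (sup g T hT hT0 hgb g1) ?_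
  · have r1 : ∀ x, ENNReal.ofReal (f x / S).toReal = f x / S := fun x =>
      ENNReal.ofReal_toReal (ne_top_of_le_ne_top (by simp) (f1 x))
    have r2 : ∀ x, ENNReal.ofReal (g x / T).toReal = g x / T := fun x =>
      ENNReal.ofReal_toReal (ne_top_of_le_ne_top (by simp) (g1 x))
    have r3 : ∀ x, ENNReal.ofReal (min (h x / c) 1).toReal ≤ h x / c := fun x =>
      ENNReal.ofReal_toReal_le.trans (min_le_left _ _)
    simp only [r1, r2] at key
    have key2 := (amgm hp hq hpq _ _).trans (key.trans (lintegral_mono r3))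
    simp only [div_eq_mul_inv] at key2
    rw [lintegral_mul_const _ hf, lintegral_mul_const _ hg, lintegral_mul_const _ hh,
      ENNReal.mul_rpow_of_nonneg _ _ hp.le, ENNReal.mul_rpow_of_nonneg _ _ hq.le,
      ENNReal.inv_rpow, ENNReal.inv_rpow] at key2
    have e : ((∫⁻ x, f x) ^ p * (S ^ p)⁻¹ * ((∫⁻ x, g x) ^ q * (T ^ q)⁻¹)) =
      ((∫⁻ x, f x) ^ p * (∫⁻ x, g x) ^ q) * c⁻¹ := by
      rw [hc, ENNReal.mul_inv (Or.inl hSp0) (Or.inl hSp)]; ring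
    rw [e] at key2
    rwa [ENNReal.mul_le_mul_iff_left (by simpa using hct) (by simpa using hc0)] at key2
  · intro d hd x y hx hy
    rw [← ENNReal.ofReal_lt_iff_lt_toReal hd.le (ne_top_of_le_ne_top (by simp) (f1 x))] at hx
    rw [← ENNReal.ofReal_lt_iff_lt_toReal hd.le (ne_top_of_le_ne_top (by simp) (g1 y))] at hy
    rw [← ENNReal.ofReal_lt_iff_lt_toReal hd.le (ne_top_of_le_ne_top (by simp) (min_le_right _ _))]
    refine lt_min ?_ (hx.trans_le (f1 x))
    set D := ENNReal.ofReal d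
    have hD0 : D ≠ 0 := by simpa [D] using hd
    have hDt : D ≠ ∞ := by simp [D]
    have : D ^ p * D ^ q < (f x / S) ^ p * (g y / T) ^ q :=
      ENNReal.mul_lt_mul (ENNReal.rpow_lt_rpow hx hp) (ENNReal.rpow_lt_rpow hy hq)
    rw [← ENNReal.rpow_add _ _ hD0 hDt, hpq, ENNReal.rpow_one] at this
    refine this.trans_le ?_
    rw [ENNReal.div_rpow_of_nonneg _ _ hp.le, ENNReal.div_rpow_of_nonneg _ _ hq.le]
    refine le_trans (le_of_eq ?_) (ENNReal.div_le_div_right (H x y) c)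
    simp only [div_eq_mul_inv]
    rw [hc, ENNReal.mul_inv (Or.inl hSp0) (Or.inl hSp)]; ring

def PL (V : Type) [AddCommGroup V] [Module ℝ V] [MeasureSpace V] : Prop :=
  ∀ p q : ℝ, 0 < p → 0 < q → p + q = 1 → ∀ f g h : V → ℝ≥0∞, Measurable f → Measurable g →
    Measurable h → (∀ x y, f x ^ p * g y ^ q ≤ h (p • x + q • y)) →
    (∫⁻ x, f x) ^ p * (∫⁻ x, g x) ^ q ≤ ∫⁻ x, h x

lemma trunc {f : ℝ → ℝ≥0∞} (hf : Measurable f) {p : ℝ} (hp : 0 < p) :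
    (∫⁻ x, f x) ^ p = ⨆ n : ℕ, (∫⁻ x, min (f x) n) ^ p := by
  have h1 : (∫⁻ x, f x) = ⨆ n : ℕ, (∫⁻ x, min (f x) n) := by
    rw [← lintegral_iSup (fun n => by fun_prop)]
    · congr 1
      ext x
      rw [← inf_iSup_eq]
      simp [ENNReal.iSup_natCast]
    · intro m n hmn x
      exact min_le_min le_rfl (by exact_mod_cast hmn)
  rw [h1]
  exact (ENNReal.orderIsoRpow p hp).map_iSup _

lemma pl_real : PL ℝ := by
  intro p q hp hq hpq f g h hf hg hh H
  rw [trunc hf hp, trunc hg hq]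
  simp only [ENNReal.iSup_mul, ENNReal.mul_iSup, iSup_le_iff]
  intro m n
  refine pl_bdd hp hq hpq (by fun_prop) (by fun_prop) hh ?_ ?_ ?_
  · exact ne_top_of_le_ne_top (ENNReal.natCast_ne_top _) (iSup_le fun x => min_le_right _ _)
  · exact ne_top_of_le_ne_top (ENNReal.natCast_ne_top _) (iSup_le fun x => min_le_right _ _)
  · intro x y
    refine le_trans ?_ (H x y)
    gcongr <;> exact min_le_left _ _

lemma pl_prod {V W : Type} [AddCommGroup V] [Module ℝ V] [MeasureSpace V] [AddCommGroup W]
    [Module ℝ W] [MeasureSpace W] [SFinite (volume : Measure W)]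
    (hV : PL V) (hW : PL W) : PL (V × W) := by
  intro p q hp hq hpq f g h hf hg hh H
  rw [Measure.volume_eq_prod, lintegral_prod _ hf.aemeasurable, lintegral_prod _ hg.aemeasurable,
    lintegral_prod _ hh.aemeasurable]
  refine hV p q hp hq hpq _ _ _ hf.lintegral_prod_right' hg.lintegral_prod_right'
    hh.lintegral_prod_right' ?_
  intro x y
  refine hW p q hp hq hpq _ _ _ (by fun_prop) (by fun_prop) (by fun_prop) ?_
  intro x' y'
  exact H (x, x') (y, y')

lemma pl_transfer {V W : Type} [AddCommGroup V] [Module ℝ V] [MeasureSpace V] [AddCommGroup W]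
    [Module ℝ W] [MeasureSpace W] (e : V ≃ᵐ W) (he : MeasurePreserving e)
    (hl : ∀ (p q : ℝ) x y, e.symm (p • x + q • y) = p • e.symm x + q • e.symm y)
    (hW : PL W) : PL V := by
  intro p q hp hq hpq f g h hf hg hh H
  have hs := he.symm
  rw [← hs.lintegral_comp hf, ← hs.lintegral_comp hg, ← hs.lintegral_comp hh]
  refine hW p q hp hq hpq _ _ _ (by fun_prop) (by fun_prop) (by fun_prop) ?_
  intro x y
  rw [hl]
  exact H _ _

lemma pl_pi (n : ℕ) : PL (Fin n → ℝ) := by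
  induction n with
  | zero =>
    intro p q hp hq hpq f g h hf hg hh H
    rw [volume_pi, Measure.pi_of_empty]
    simp only [lintegral_dirac]
    convert H _ _ using 2
  | succ n ih =>
    refine pl_transfer (MeasurableEquiv.piFinSuccAbove (fun _ => ℝ) 0)
      (volume_preserving_piFinSuccAbove (fun _ : Fin (n + 1) => ℝ) 0) ?_ (pl_prod pl_real ih)
    intro p q x y
    ext i
    refine Fin.cases ?_ (fun j => ?_) i <;> simp [MeasurableEquiv.piFinSuccAbove]

lemma pl_euc (n : ℕ) : PL (EuclideanSpace ℝ (Fin n)) := by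
  refine pl_transfer (MeasurableEquiv.toLp 2 (Fin n → ℝ)).symm
    (EuclideanSpace.volume_preserving_symm_measurableEquiv_toLp _) ?_ (pl_pi n)
  intro p q x y
  ext i
  simp

lemma bm_ball {n : ℕ} {a r : ℝ} (ha : 0 < a) (hr : 0 < r) {A : Set (EuclideanSpace ℝ (Fin n))}
    (hA : MeasurableSet A) (hvol : volume A = volume (ball (0 : EuclideanSpace ℝ (Fin n)) a)) :
    volume (ball (0 : EuclideanSpace ℝ (Fin n)) (a + r)) ≤ volume (thickening r A) := by
  set p := a / (a + r) with hp
  set q := r / (a + r) with hq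
  have hp0 : 0 < p := by positivity
  have hq0 : 0 < q := by positivity
  have hpq : p + q = 1 := by rw [hp, hq]; field_simp
  set B := ball (0 : EuclideanSpace ℝ (Fin n)) (a + r) with hB
  set A' := (fun x : EuclideanSpace ℝ (Fin n) => p • x) ⁻¹' A with hA'
  have hA'm : MeasurableSet A' := hA.preimage (by fun_prop)
  have hv : volume A' = volume B := by
    rw [hA', Measure.addHaar_preimage_smul _ hp0.ne', hvol,
      ← Measure.addHaar_preimage_smul _ hp0.ne']
    congr 1
    ext x
    simp only [mem_preimage, hB, mem_ball_zero_iff, norm_smul, Real.norm_eq_abs, abs_of_pos hp0]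
    rw [hp, div_mul_eq_mul_div, div_lt_iff₀ (by positivity), mul_lt_mul_iff_right₀ ha]
  have key := pl_euc n p q hp0 hq0 hpq (A'.indicator 1) (B.indicator 1)
    ((thickening r A).indicator 1) (measurable_one.indicator hA'm)
    (measurable_one.indicator measurableSet_ball)
    (measurable_one.indicator isOpen_thickening.measurableSet) ?_
  · rw [lintegral_indicator_one hA'm, lintegral_indicator_one measurableSet_ball,
      lintegral_indicator_one isOpen_thickening.measurableSet, hv,
      ← ENNReal.rpow_add _ _ (measure_ball_pos _ _ (by positivity)).ne' measure_ball_lt_top.ne,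
      hpq, ENNReal.rpow_one] at key
    exact key
  · intro x y
    by_cases hx : x ∈ A'
    · by_cases hy : y ∈ B
      · have : p • x + q • y ∈ thickening r A := by
          rw [mem_thickening_iff]
          refine ⟨p • x, hx, ?_⟩
          rw [dist_eq_norm, add_sub_cancel_left, norm_smul, Real.norm_eq_abs, abs_of_pos hq0]
          rw [hB, mem_ball_zero_iff] at hy
          rw [hq, div_mul_eq_mul_div, div_lt_iff₀ (by positivity)]
          gcongr
        simp [this, hx, hy]
      · simp [hy, hq0]
    · simp [hx, hp0]

lemma exists_radius {n : ℕ} (hn : 1 ≤ n) {v : ℝ≥0∞} (h0 : v ≠ 0) (ht : v ≠ ∞) :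
    ∃ a > 0, volume (ball (0 : EuclideanSpace ℝ (Fin n)) a) = v := by
  have : Nonempty (Fin n) := ⟨⟨0, hn⟩⟩
  set w := volume (ball (0 : EuclideanSpace ℝ (Fin n)) 1) with hw
  have hw0 : w ≠ 0 := (measure_ball_pos _ _ one_pos).ne'
  have hwt : w ≠ ∞ := measure_ball_lt_top.ne
  have hd : v / w ≠ ∞ := ENNReal.div_ne_top ht hw0
  have hpos : 0 < (v / w).toReal := ENNReal.toReal_pos (by simp [h0, hwt]) hd
  refine ⟨(v / w).toReal ^ ((n : ℝ)⁻¹), by positivity, ?_⟩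
  rw [Measure.addHaar_ball _ _ (by positivity), finrank_euclideanSpace_fin,
    Real.rpow_inv_natCast_pow hpos.le (by omega), ENNReal.ofReal_toReal hd,
    ENNReal.div_mul_cancel hw0 hwt]

lemma inter_ball_eq {n : ℕ} (hn : 1 ≤ n) (E : Set (EuclideanSpace ℝ (Fin n)))
    (x : EuclideanSpace ℝ (Fin n)) (ρ : ℝ) :
    volume (E ∩ closedBall x ρ) = volume (E ∩ ball x ρ) := by
  have : Nonempty (Fin n) := ⟨⟨0, hn⟩⟩
  have h : (ball x ρ : Set (EuclideanSpace ℝ (Fin n))) =ᵐ[volume] closedBall x ρ :=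
    ae_eq_of_subset_of_measure_ge ball_subset_closedBall
      (Measure.addHaar_closedBall_eq_addHaar_ball _ _ _).le
      measurableSet_ball.nullMeasurableSet measure_closedBall_lt_top.ne
  exact measure_congr ((ae_eq_refl E).inter h.symm)

lemma density_ae {n : ℕ} (hn : 1 ≤ n) {E : Set (EuclideanSpace ℝ (Fin n))}
    (hE : MeasurableSet E) : densityOnePoints n E =ᵐ[volume] E := by
  have : Nonempty (Fin n) := ⟨⟨0, hn⟩⟩
  rw [Filter.eventuallyEq_set]
  filter_upwards [Besicovitch.ae_tendsto_measure_inter_div_of_measurableSet volume hE] with x hx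
  simp only [inter_ball_eq hn, Measure.addHaar_closedBall_eq_addHaar_ball] at hx
  by_cases h : x ∈ E
  · simp only [h, indicator_of_mem, Pi.one_apply] at hx
    exact iff_of_true hx h
  · simp only [h, not_false_eq_true, indicator_of_notMem] at hx
    refine iff_of_false (fun h' => ?_) h
    exact zero_ne_one (tendsto_nhds_unique hx h')

lemma subset_density {n : ℕ} {U : Set (EuclideanSpace ℝ (Fin n))} (hU : IsOpen U) :
    U ⊆ densityOnePoints n U := by
  intro x hx
  obtain ⟨ε, hε, hb⟩ := Metric.isOpen_iff.1 hU x hx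
  refine tendsto_const_nhds.congr' ?_
  filter_upwards [Ioo_mem_nhdsGT hε] with ρ hρ
  rw [inter_eq_right.2 ((ball_subset_ball hρ.2.le).trans hb)]
  exact (ENNReal.div_self (measure_ball_pos _ _ hρ.1).ne' measure_ball_lt_top.ne).symm

lemma density_subset {n : ℕ} (U : Set (EuclideanSpace ℝ (Fin n))) :
    densityOnePoints n U ⊆ closure U := by
  intro x hx
  by_contra hc
  obtain ⟨ε, hε, hb⟩ := Metric.isOpen_iff.1 isClosed_closure.isOpen_compl x hc
  refine zero_ne_one (α := ℝ≥0∞) (tendsto_nhds_unique (tendsto_const_nhds.congr' ?_) hx)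
  filter_upwards [Ioo_mem_nhdsGT hε] with ρ hρ
  have : U ∩ ball x ρ = ∅ := by
    ext y
    simp only [mem_inter_iff, mem_empty_iff_false, iff_false, not_and]
    exact fun hy hy' => hb (ball_subset_ball hρ.2.le hy') (subset_closure hy)
  simp [this]

lemma frontier_meets {n : ℕ} {F : Set (EuclideanSpace ℝ (Fin n))} {x : EuclideanSpace ℝ (Fin n)}
    {r : ℝ} (h1 : (ball x r ∩ F).Nonempty) (h2 : ¬ ball x r ⊆ F) :
    x ∈ thickening r (frontier F) := by
  by_contra hx
  have hd : ball x r ∩ frontier F = ∅ := by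
    ext y
    simp only [mem_inter_iff, mem_empty_iff_false, iff_false, not_and]
    intro hy hy'
    exact hx (mem_thickening_iff.2 ⟨y, hy', by rwa [dist_comm]⟩)
  have hcov : ball x r ⊆ interior F ∪ (closure F)ᶜ := by
    intro y hy
    by_contra hc
    simp only [mem_union, mem_compl_iff, not_or, not_not] at hc
    have : y ∈ ball x r ∩ frontier F := ⟨hy, hc.2, hc.1⟩
    simp [hd] at this
  have hpre : IsPreconnected (ball x r) := (convex_ball x r).isPreconnected
  obtain ⟨y, hy, hyF⟩ := h1
  obtain ⟨z, hz, hzF⟩ := not_subset.1 h2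
  have hy' : y ∈ interior F := (hcov hy).resolve_right (fun h => h (subset_closure hyF))
  have hz' : z ∈ (closure F)ᶜ := (hcov hz).resolve_left (fun h => hzF (interior_subset h))
  obtain ⟨w, _, hw1, hw2⟩ := hpre _ _ isOpen_interior isClosed_closure.isOpen_compl hcov
    ⟨y, hy, hy'⟩ ⟨z, hz, hz'⟩
  exact hw2 (interior_subset_closure hw1)

/-- Isoperimetric inequality for the `r`-perimeter: among measurable sets with the same volume
as the ball `B_R`, the ball minimizes `Per_r`. -/
theorem isoperimetric (n : ℕ) (hn : 1 ≤ n) (R : ℝ) (hR : 0 < R) (r : ℝ) (hr : 0 < r)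
    (E : Set (EuclideanSpace ℝ (Fin n))) (hE : MeasurableSet E)
    (hvol : volume E = volume (ball (0 : EuclideanSpace ℝ (Fin n)) R)) :
    perR n r (ball (0 : EuclideanSpace ℝ (Fin n)) R) Set.univ ≤ perR n r E Set.univ := by
  have : Nonempty (Fin n) := ⟨⟨0, hn⟩⟩
  unfold perR
  simp only [inter_univ]
  apply ENNReal.div_le_div_right
  set F := densityOnePoints n E with hF
  have hFE : F =ᵐ[volume] E := density_ae hn hE
  have hFv : volume F = volume (ball (0 : EuclideanSpace ℝ (Fin n)) R) :=
    (measure_congr hFE).trans hvol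
  -- outer estimate
  have houter : volume (ball (0 : EuclideanSpace ℝ (Fin n)) (R + r)) ≤ volume (thickening r F) := by
    obtain ⟨A, hAF, hA, hAe⟩ :=
      (NullMeasurableSet.congr hE.nullMeasurableSet hFE.symm).exists_measurable_subset_ae_eq
    exact (bm_ball hR hr hA ((measure_congr hAe).trans hFv)).trans
      (measure_mono (thickening_subset_of_subset r hAF))
  -- inner estimate
  set G := {x | ball x r ⊆ F} with hG
  have hGc : G = (thickening r Fᶜ)ᶜ := by
    ext x
    simp only [hG, mem_setOf_eq, mem_compl_iff, mem_thickening_iff, not_exists, not_and]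
    constructor
    · intro h y hy hd
      exact hy (h (by rwa [mem_ball, dist_comm]))
    · intro h y hy
      by_contra hc
      exact h y hc (by rwa [dist_comm])
  have hGm : MeasurableSet G := by
    rw [hGc]; exact isOpen_thickening.measurableSet.compl
  have hGF : G ⊆ F := fun x hx => hx (mem_ball_self hr)
  have hGtF : thickening r G ⊆ F := by
    intro x hx
    obtain ⟨y, hy, hd⟩ := mem_thickening_iff.1 hx
    exact hy hd
  have hGt : volume G ≠ ∞ :=
    ne_top_of_le_ne_top (hFv ▸ measure_ball_lt_top.ne) (measure_mono hGF)
  have hinner : volume G ≤ volume (ball (0 : EuclideanSpace ℝ (Fin n)) (R - r)) := by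
    by_cases h0 : volume G = 0
    · simp [h0]
    obtain ⟨a, ha, hav⟩ := exists_radius hn h0 hGt
    have h1 := (bm_ball ha hr hGm hav.symm).trans (measure_mono hGtF)
    rw [hFv, Measure.addHaar_ball _ _ (by positivity), Measure.addHaar_ball _ _ hR.le,
      ENNReal.mul_le_mul_iff_left (measure_ball_pos _ _ one_pos).ne' measure_ball_lt_top.ne,
      ENNReal.ofReal_le_ofReal_iff (by positivity), finrank_euclideanSpace_fin,
      pow_le_pow_iff_left₀ (by positivity) hR.le (by omega)] at h1
    rw [← hav]
    exact measure_mono (ball_subset_ball (by linarith))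
  -- the ball
  have hball : thickening r (frontier (densityOnePoints n (ball 0 R))) ⊆
      ball (0 : EuclideanSpace ℝ (Fin n)) (R + r) \ ball 0 (R - r) := by
    intro x hx
    obtain ⟨y, hy, hd⟩ := mem_thickening_iff.1 hx
    have hy1 : ‖y‖ ≤ R := by
      have := closure_mono (density_subset _) hy.1
      rw [closure_closure, closure_ball _ hR.ne'] at this
      simpa using this
    have hy2 : R ≤ ‖y‖ := by
      by_contra! hc
      exact hy.2 (interior_maximal (subset_density isOpen_ball) isOpen_ball (by simpa using hc))
    rw [dist_eq_norm] at hd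
    have h1 := norm_sub_norm_le x y
    have h2 := norm_sub_norm_le y x
    rw [norm_sub_rev] at h2
    simp only [mem_diff, mem_ball_zero_iff, not_lt]
    constructor <;> linarith
  calc _ ≤ volume (ball (0 : EuclideanSpace ℝ (Fin n)) (R + r) \ ball 0 (R - r)) :=
        measure_mono hball
    _ = volume (ball (0 : EuclideanSpace ℝ (Fin n)) (R + r)) - volume (ball 0 (R - r)) :=
        measure_diff (ball_subset_ball (by linarith)) measurableSet_ball.nullMeasurableSet
          measure_ball_lt_top.ne
    _ ≤ volume (thickening r F) - volume G := tsub_le_tsub houter hinner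
    _ ≤ volume (thickening r F \ G) := le_measure_diff
    _ ≤ _ := by
      apply measure_mono
      rintro x ⟨hx, hxG⟩
      obtain ⟨y, hy, hd⟩ := mem_thickening_iff.1 hx
      exact frontier_meets ⟨y, by rwa [mem_ball, dist_comm], hy⟩ hxG
end
end

section
/- Failure of regularity and compactness under a large volume term: for every n ≥ 1 there exists a constant C > 0, depending only on n, such that the following holds. Let r > 0 and K ≥ C/r, and define for bounded measurable E ⊆ ℝⁿ the functional F_K(E) := Per_r(E) − K Lⁿ(E ∩ (B_r \ B_{r/2})). Then for every measurable set U ⊆ B_{r/2}, the set E_U := (B_r \ B_{r/2}) ∪ U satisfies F_K(E_U) ≤ F_K(E) for every bounded measurable set E ⊆ ℝⁿ. In particular, the annulus B_r \ B_{r/2} minimizes F_K among bounded measurable sets, and every modification of it by an arbitrary measurable subset of B_{r/2} is again a minimizer. -/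
open MeasureTheory Metric Set Filter Topology
open scoped RealInnerProductSpace ENNReal

noncomputable section

/-- The functional `F_K(E) = Per_r(E) - K Lⁿ(E ∩ (B_r \ B_{r/2}))`, as an extended real. -/
def FK (n : ℕ) (r K : ℝ) (E : Set (EuclideanSpace ℝ (Fin n))) : EReal :=
  (perR n r E Set.univ : EReal) -
    ((K * (volume (E ∩ (ball (0 : EuclideanSpace ℝ (Fin n)) r \
        ball (0 : EuclideanSpace ℝ (Fin n)) (r / 2)))).toReal : ℝ) : EReal)

lemma dop_subset_closure (n : ℕ) (E : Set (EuclideanSpace ℝ (Fin n))) :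
    densityOnePoints n E ⊆ closure E := by
  intro x hx
  by_contra hxc
  obtain ⟨ε, hε, hb⟩ := Metric.isOpen_iff.1 isClosed_closure.isOpen_compl x hxc
  have h0 : (fun ρ : ℝ => volume (E ∩ ball x ρ) / volume (ball x ρ)) =ᶠ[𝓝[>] 0]
      fun _ => (0 : ℝ≥0∞) := by
    have hmem : Ioo (0 : ℝ) ε ∈ 𝓝[>] (0 : ℝ) := Ioo_mem_nhdsGT hε
    filter_upwards [hmem] with ρ hρ
    have he : E ∩ ball x ρ = ∅ := by
      ext y
      simp only [mem_inter_iff, mem_empty_iff_false, iff_false, not_and]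
      intro hy hy2
      exact hb (ball_subset_ball hρ.2.le hy2) (subset_closure hy)
    rw [he]; simp
  have h1 : Tendsto (fun ρ : ℝ => volume (E ∩ ball x ρ) / volume (ball x ρ)) (𝓝[>] 0) (𝓝 0) :=
    (tendsto_congr' h0).2 tendsto_const_nhds
  exact zero_ne_one (tendsto_nhds_unique h1 hx)

lemma dop_ae (n : ℕ) (E : Set (EuclideanSpace ℝ (Fin n))) (hE : MeasurableSet E) :
    volume (E \ densityOnePoints n E) = 0 := by
  have h := Besicovitch.ae_tendsto_measure_inter_div
    (volume : Measure (EuclideanSpace ℝ (Fin n))) E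
  rw [ae_restrict_iff' hE] at h
  refine measure_mono_null ?_ h
  rintro x ⟨hxE, hxD⟩
  simp only [mem_compl_iff, mem_ofPred_eq]
  intro hh
  refine hxD ((tendsto_congr' ?_).1 (hh hxE))
  filter_upwards [self_mem_nhdsWithin] with ρ hρ
  have hρ' : (0 : ℝ) < ρ := hρ
  have hs : volume (sphere x ρ) = 0 := Measure.addHaar_sphere_of_ne_zero volume x hρ'.ne'
  have hae : (closedBall x ρ : Set (EuclideanSpace ℝ (Fin n))) =ᵐ[volume] ball x ρ := by
    rw [ae_eq_set]
    refine ⟨by rw [closedBall_sdiff_ball]; exact hs, ?_⟩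
    rw [sdiff_eq_empty.2 ball_subset_closedBall]; simp
  rw [measure_congr hae, measure_congr ((ae_eq_refl E).inter hae)]

lemma thick_aux {V : Type*} [NormedAddCommGroup V] [NormedSpace ℝ V] (r : ℝ) (D : Set V) (x : V)
    (hx : x ∈ thickening r D) (hx2 : x ∉ thickening r (frontier D)) : ball x r ⊆ D := by
  have hpc : IsPreconnected (ball x r) := (convex_ball x r).isPreconnected
  have hsub : ball x r ⊆ interior D ∪ (closure D)ᶜ := by
    intro y hy
    by_contra hc
    simp only [mem_union, mem_compl_iff, not_or, not_not] at hc
    exact hx2 (mem_thickening_iff.2 ⟨y, ⟨hc.2, hc.1⟩, by rw [dist_comm]; exact hy⟩)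
  obtain ⟨z, hz, hxz⟩ := mem_thickening_iff.1 hx
  have hzb : z ∈ ball x r := by rw [mem_ball, dist_comm]; exact hxz
  have hzi : z ∈ interior D := by
    rcases hsub hzb with h | h
    · exact h
    · exact absurd (subset_closure hz) h
  refine (hpc.subset_left_of_subset_union isOpen_interior isClosed_closure.isOpen_compl ?_ hsub
    ⟨z, hzb, hzi⟩).trans interior_subset
  exact disjoint_left.2 fun y hy hy2 => hy2 (subset_closure (interior_subset hy))

lemma midpt {V : Type*} [NormedAddCommGroup V] [NormedSpace ℝ V] {r : ℝ} {D : Set V} {p x : V}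
    (hp : ball p r ⊆ D) (hx : x ∈ ball p (2 * r)) : x ∈ thickening r D := by
  rw [mem_ball] at hx
  refine mem_thickening_iff.2 ⟨midpoint ℝ p x, hp ?_, ?_⟩
  · rw [mem_ball, dist_midpoint_left, dist_comm]; norm_num; linarith
  · rw [dist_comm, dist_midpoint_right, dist_comm]; norm_num; linarith

lemma case_nonempty (n : ℕ) (hn : 1 ≤ n) (r : ℝ) (D : Set (EuclideanSpace ℝ (Fin n)))
    (hr : 0 < r) (hb : Bornology.IsBounded D) (hT : ∃ p, ball p r ⊆ D) :
    volume (ball (0 : EuclideanSpace ℝ (Fin n)) (2 * r)) ≤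
      volume (thickening r (frontier D)) := by
  let i : Fin n := ⟨0, hn⟩
  let T : Set (EuclideanSpace ℝ (Fin n)) := {p | ball p r ⊆ D}
  have hTc : IsClosed T := by
    have : T = ⋂ y ∈ Dᶜ, {p | r ≤ dist y p} := by
      ext p
      simp only [T, mem_ofPred_eq, mem_iInter, mem_compl_iff]
      constructor
      · intro h y hy
        by_contra hc
        exact hy (h (mem_ball.2 (not_le.1 hc)))
      · intro h y hy
        by_contra hc
        exact absurd (h y hc) (not_le.2 hy)
    rw [this]
    exact isClosed_biInter fun y _ => isClosed_le continuous_const (by fun_prop)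
  have hTb : Bornology.IsBounded T := hb.subset fun p hp => hp (mem_ball_self hr)
  have hTk : IsCompact T := Metric.isCompact_of_isClosed_isBounded hTc hTb
  have hcont : Continuous fun x : EuclideanSpace ℝ (Fin n) => x i := by fun_prop
  obtain ⟨p, hpT, hp⟩ := hTk.exists_isMaxOn hT hcont.continuousOn
  obtain ⟨q, hqT, hq⟩ := hTk.exists_isMinOn hT hcont.continuousOn
  let Hp : Set (EuclideanSpace ℝ (Fin n)) := ball 0 (2 * r) ∩ {x | 0 < x i}
  let Hm : Set (EuclideanSpace ℝ (Fin n)) := ball 0 (2 * r) ∩ {x | x i < 0}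
  let H0 : Set (EuclideanSpace ℝ (Fin n)) := {x | x i = 0}
  have hH0 : volume H0 = 0 := by
    let S : Submodule ℝ (EuclideanSpace ℝ (Fin n)) :=
      { carrier := H0
        add_mem' := by intro a b ha hb; simp only [H0, mem_ofPred_eq] at *; simp [ha, hb]
        zero_mem' := by simp [H0]
        smul_mem' := by intro c a ha; simp only [H0, mem_ofPred_eq] at *; simp [ha] }
    refine Measure.addHaar_submodule volume S ?_
    intro hS
    have : EuclideanSpace.single i (1 : ℝ) ∈ S := by rw [hS]; trivial
    have h2 : (EuclideanSpace.single i (1 : ℝ) : EuclideanSpace ℝ (Fin n)) i = 0 := this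
    simp at h2
  let Pp : Set (EuclideanSpace ℝ (Fin n)) := (fun x => -p + x) ⁻¹' Hp
  let Pm : Set (EuclideanSpace ℝ (Fin n)) := (fun x => -q + x) ⁻¹' Hm
  have hPp : volume Pp = volume Hp := measure_preimage_add _ _ _
  have hPm : volume Pm = volume Hm := measure_preimage_add _ _ _
  have hHm : MeasurableSet Hm := measurableSet_ball.inter (isOpen_lt hcont continuous_const).measurableSet
  have hPmm : MeasurableSet Pm := (measurable_const_add (-q)) hHm
  have hpq : q i ≤ p i := hp hqT
  have hdisj : Disjoint Pp Pm := by
    rw [disjoint_left]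
    rintro x ⟨_, h1⟩ ⟨_, h2⟩
    simp only [mem_ofPred_eq, PiLp.add_apply, PiLp.neg_apply] at h1 h2
    linarith
  have hsub : Pp ∪ Pm ⊆ thickening r (frontier D) := by
    rintro x (⟨h1, h2⟩ | ⟨h1, h2⟩)
    · simp only [mem_ofPred_eq, PiLp.add_apply, PiLp.neg_apply] at h2
      by_contra hc
      have hx : x ∈ thickening r D := by
        refine midpt hpT ?_
        rw [mem_ball, dist_eq_norm]
        rw [mem_ball_zero_iff] at h1
        rwa [sub_eq_neg_add]
      have hxT : x ∈ T := thick_aux r D x hx hc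
      have : x i ≤ p i := hp hxT
      linarith
    · simp only [mem_ofPred_eq, PiLp.add_apply, PiLp.neg_apply] at h2
      by_contra hc
      have hx : x ∈ thickening r D := by
        refine midpt hqT ?_
        rw [mem_ball, dist_eq_norm]
        rw [mem_ball_zero_iff] at h1
        rwa [sub_eq_neg_add]
      have hxT : x ∈ T := thick_aux r D x hx hc
      have : q i ≤ x i := hq hxT
      linarith
  calc volume (ball (0 : EuclideanSpace ℝ (Fin n)) (2 * r))
      ≤ volume ((Hp ∪ Hm) ∪ H0) := by
        refine measure_mono fun x hx => ?_
        rcases lt_trichotomy (x i) 0 with h | h | h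
        · exact Or.inl (Or.inr ⟨hx, h⟩)
        · exact Or.inr h
        · exact Or.inl (Or.inl ⟨hx, h⟩)
    _ ≤ volume (Hp ∪ Hm) + volume H0 := measure_union_le _ _
    _ ≤ volume Hp + volume Hm := by rw [hH0, add_zero]; exact measure_union_le _ _
    _ = volume (Pp ∪ Pm) := by rw [measure_union hdisj hPmm, hPp, hPm]
    _ ≤ _ := measure_mono hsub

lemma exists_center (n : ℕ) (hn : 1 ≤ n) (r : ℝ) (hr : 0 < r) (x : EuclideanSpace ℝ (Fin n))
    (hx : ‖x‖ < r) : ∃ y : EuclideanSpace ℝ (Fin n), ‖y‖ = 3 * r / 4 ∧ dist x y ≤ 3 * r / 4 := by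
  by_cases h0 : x = 0
  · refine ⟨EuclideanSpace.single ⟨0, hn⟩ (3 * r / 4), ?_, ?_⟩
    · simp; linarith
    · subst h0; simp [abs_of_pos hr]
  · have hpos : 0 < ‖x‖ := norm_pos_iff.2 h0
    refine ⟨(3 * r / 4 / ‖x‖) • x, ?_, ?_⟩
    · rw [norm_smul, Real.norm_of_nonneg (by positivity)]; field_simp
    · have : x - (3 * r / 4 / ‖x‖) • x = (1 - 3 * r / 4 / ‖x‖) • x := by rw [sub_smul, one_smul]
      rw [dist_eq_norm, this, norm_smul, Real.norm_eq_abs, ← abs_of_pos hpos, ← abs_mul,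
        abs_of_pos hpos, sub_mul, div_mul_cancel₀ _ hpos.ne', abs_le]
      constructor <;> linarith

open scoped Pointwise in
lemma key (n : ℕ) (hn : 1 ≤ n) (r : ℝ) (hr : 0 < r) (E : Set (EuclideanSpace ℝ (Fin n)))
    (hE : MeasurableSet E) (hb : Bornology.IsBounded E) :
    volume (ball (0 : EuclideanSpace ℝ (Fin n)) (2 * r)) ≤
      volume (thickening r (frontier (densityOnePoints n E))) +
        ENNReal.ofReal (8 ^ n) * volume ((ball (0 : EuclideanSpace ℝ (Fin n)) r \
          ball (0 : EuclideanSpace ℝ (Fin n)) (r / 2)) \ E) := by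
  set D := densityOnePoints n E with hD
  set A := (ball (0 : EuclideanSpace ℝ (Fin n)) r \
          ball (0 : EuclideanSpace ℝ (Fin n)) (r / 2)) with hA
  have hDb : Bornology.IsBounded D := hb.closure.subset (dop_subset_closure n E)
  by_cases hT : ∃ p, ball p r ⊆ D
  · exact (case_nonempty n hn r D hr hDb hT).trans le_self_add
  have hth : thickening r D ⊆ thickening r (frontier D) := by
    intro x hx
    by_contra hc
    exact hT ⟨x, thick_aux r D x hx hc⟩
  have hAD : volume (A \ D) ≤ volume (A \ E) := by
    calc volume (A \ D) ≤ volume ((A \ E) ∪ (E \ D)) := by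
          refine measure_mono fun x hx => ?_
          by_cases h : x ∈ E
          · exact Or.inr ⟨h, hx.2⟩
          · exact Or.inl ⟨hx.1, h⟩
      _ ≤ volume (A \ E) + volume (E \ D) := measure_union_le _ _
      _ = volume (A \ E) := by rw [dop_ae n E hE, add_zero]
  by_cases hB : ball (0 : EuclideanSpace ℝ (Fin n)) r ⊆ thickening r D
  · have hs : ball (0 : EuclideanSpace ℝ (Fin n)) (2 * r) ⊆
        thickening r (frontier D) ∪ (2 : ℝ) • (A \ D) := by
      intro x hx
      by_cases hxt : x ∈ thickening r D
      · exact Or.inl (hth hxt)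
      right
      have hxr : r ≤ ‖x‖ := by
        by_contra hc
        exact hxt (hB (mem_ball_zero_iff.2 (not_le.1 hc)))
      rw [mem_ball_zero_iff] at hx
      have hnorm : ‖(2⁻¹ : ℝ) • x‖ = ‖x‖ / 2 := by
        rw [norm_smul]; norm_num; ring
      refine ⟨(2⁻¹ : ℝ) • x, ⟨⟨?_, ?_⟩, ?_⟩, ?_⟩
      · rw [mem_ball_zero_iff, hnorm]; linarith
      · rw [mem_ball_zero_iff, hnorm]; linarith
      · intro hxD
        refine hxt (mem_thickening_iff.2 ⟨_, hxD, ?_⟩)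
        have : x - (2⁻¹ : ℝ) • x = (2⁻¹ : ℝ) • x := by
          nth_rewrite 1 [← one_smul ℝ x]
          rw [← sub_smul]; norm_num
        rw [dist_eq_norm, this, hnorm]; linarith
      · simp
    refine (measure_mono hs).trans ((measure_union_le _ _).trans ?_)
    refine add_le_add le_rfl ?_
    rw [Measure.addHaar_smul, finrank_euclideanSpace_fin, abs_of_pos (by positivity)]
    refine mul_le_mul' (ENNReal.ofReal_le_ofReal ?_) hAD
    gcongr
    norm_num
  · obtain ⟨x, hx, hxt⟩ := not_subset.1 hB
    rw [mem_ball_zero_iff] at hx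
    obtain ⟨y, hy1, hy2⟩ := exists_center n hn r hr x hx
    have hs : ball y (r / 4) ⊆ A \ D := by
      intro z hz
      rw [mem_ball] at hz
      have h1 : ‖z‖ ≤ ‖y‖ + dist z y := by
        rw [dist_eq_norm]; have := norm_add_le y (z - y); simpa using this
      have h2 : ‖y‖ ≤ ‖z‖ + dist z y := by
        rw [dist_comm, dist_eq_norm]; have := norm_add_le z (y - z); simpa using this
      refine ⟨⟨?_, ?_⟩, ?_⟩
      · rw [mem_ball_zero_iff]; linarith
      · rw [mem_ball_zero_iff]; linarith
      · intro hzD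
        refine hxt (mem_thickening_iff.2 ⟨z, hzD, ?_⟩)
        have := dist_triangle x y z
        rw [dist_comm y z] at this
        linarith
    have h8 : volume (ball (0 : EuclideanSpace ℝ (Fin n)) (2 * r)) =
        ENNReal.ofReal (8 ^ n) * volume (ball (0 : EuclideanSpace ℝ (Fin n)) (r / 4)) := by
      have := Measure.addHaar_ball_mul_of_pos volume (0 : EuclideanSpace ℝ (Fin n))
        (show (0 : ℝ) < 8 by norm_num) (r / 4)
      rw [finrank_euclideanSpace_fin] at this
      rw [← this]; congr 2; ring
    rw [h8, ← Measure.addHaar_ball_center volume y]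
    refine le_trans ?_ le_add_self
    exact mul_le_mul' le_rfl ((measure_mono hs).trans hAD)

theorem failure_regularity_compactness (n : ℕ) (hn : 1 ≤ n) :
    ∃ C : ℝ, 0 < C ∧
      ∀ r : ℝ, 0 < r → ∀ K : ℝ, C / r ≤ K →
        ∀ U : Set (EuclideanSpace ℝ (Fin n)), MeasurableSet U →
          U ⊆ ball (0 : EuclideanSpace ℝ (Fin n)) (r / 2) →
          ∀ E : Set (EuclideanSpace ℝ (Fin n)), MeasurableSet E → Bornology.IsBounded E →
            FK n r K ((ball (0 : EuclideanSpace ℝ (Fin n)) r \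
                ball (0 : EuclideanSpace ℝ (Fin n)) (r / 2)) ∪ U) ≤ FK n r K E := by
  refine ⟨8 ^ n, by positivity, ?_⟩
  intro r hr K hK U _ hU E hE hb
  have hkey := key n hn r hr E hE hb
  unfold FK perR
  simp only [inter_univ]
  set A := (ball (0 : EuclideanSpace ℝ (Fin n)) r \
          ball (0 : EuclideanSpace ℝ (Fin n)) (r / 2)) with hA
  have hAm : MeasurableSet A := measurableSet_ball.diff measurableSet_ball
  have hAfin : volume A ≠ ∞ :=
    ((measure_mono sdiff_subset).trans_lt measure_ball_lt_top).ne
  have hUA : (A ∪ U) ∩ A = A := inter_eq_right.2 subset_union_left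
  rw [hUA]
  set X := volume (thickening r (frontier (densityOnePoints n (A ∪ U)))) with hX
  set Y := volume (thickening r (frontier (densityOnePoints n E))) with hY
  set V := volume (ball (0 : EuclideanSpace ℝ (Fin n)) (2 * r)) with hV
  have hVfin : V ≠ ∞ := measure_ball_lt_top.ne
  have hXV : X ≤ V := by
    refine measure_mono ?_
    have h1 : frontier (densityOnePoints n (A ∪ U)) ⊆ closedBall 0 r := by
      refine frontier_subset_closure.trans (closure_minimal ?_ isClosed_closedBall)
      refine (dop_subset_closure n _).trans (closure_minimal ?_ isClosed_closedBall)
      refine union_subset (sdiff_subset.trans ball_subset_closedBall) (hU.trans ?_)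
      exact (ball_subset_ball (by linarith)).trans ball_subset_closedBall
    intro x hx
    obtain ⟨z, hz, hxz⟩ := mem_thickening_iff.1 hx
    have hz' := h1 hz
    rw [mem_closedBall] at hz'
    rw [mem_ball]
    linarith [dist_triangle x z 0]
  have hYfin : Y ≠ ∞ := by
    have hDb : Bornology.IsBounded (densityOnePoints n E) :=
      hb.closure.subset (dop_subset_closure n E)
    exact ((hDb.closure.subset frontier_subset_closure).thickening).measure_lt_top.ne
  have hXfin : X ≠ ∞ := (hXV.trans_lt hVfin.lt_top).ne
  have hsplit : (volume (A \ E)).toReal = (volume A).toReal - (volume (E ∩ A)).toReal := by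
    have h := measure_inter_add_sdiff (μ := volume) A hE
    have h1 : volume (A ∩ E) ≠ ∞ := ((measure_mono inter_subset_left).trans_lt hAfin.lt_top).ne
    have h2 : volume (A \ E) ≠ ∞ := ((measure_mono sdiff_subset).trans_lt hAfin.lt_top).ne
    rw [← h, ENNReal.toReal_add h1 h2, inter_comm E A]; ring
  have h2 : volume (A \ E) ≠ ∞ := ((measure_mono sdiff_subset).trans_lt hAfin.lt_top).ne
  have hreal : X.toReal ≤ Y.toReal + 8 ^ n * (volume (A \ E)).toReal := by
    have h := ENNReal.toReal_mono (ENNReal.add_ne_top.2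
      ⟨hYfin, ENNReal.mul_ne_top ENNReal.ofReal_ne_top h2⟩) (hXV.trans hkey)
    rwa [ENNReal.toReal_add hYfin (ENNReal.mul_ne_top ENNReal.ofReal_ne_top h2),
      ENNReal.toReal_mul, ENNReal.toReal_ofReal (by positivity)] at h
  have hcoe : ∀ Z : ℝ≥0∞, Z ≠ ∞ → ((Z / ENNReal.ofReal (2 * r) : ℝ≥0∞) : EReal) =
      ((Z.toReal / (2 * r) : ℝ) : EReal) := by
    intro Z hZ
    have hne : Z / ENNReal.ofReal (2 * r) ≠ ∞ :=
      ENNReal.div_ne_top hZ (by simpa using hr)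
    rw [← EReal.coe_toReal (x := ((Z / ENNReal.ofReal (2 * r) : ℝ≥0∞) : EReal))
      (by simpa using hne) (by simp), EReal.toReal_coe_ennreal, ENNReal.toReal_div,
      ENNReal.toReal_ofReal (by positivity)]
  rw [hcoe X hXfin, hcoe Y hYfin, ← EReal.coe_sub, ← EReal.coe_sub, EReal.coe_le_coe_iff]
  set δ := (volume (A \ E)).toReal with hδ
  have hδ0 : 0 ≤ δ := ENNReal.toReal_nonneg
  have h3 : X.toReal / (2 * r) ≤ Y.toReal / (2 * r) + 8 ^ n / r * δ := by
    have : Y.toReal / (2 * r) + 8 ^ n / r * δ = (Y.toReal + 2 * (8 ^ n * δ)) / (2 * r) := by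
      field_simp
    rw [this]
    gcongr
    have : 0 ≤ 8 ^ n * δ := by positivity
    linarith
  have h4 : 8 ^ n / r * δ ≤ K * δ := by gcongr
  have h5 : K * δ = K * (volume A).toReal - K * (volume (E ∩ A)).toReal := by
    rw [hsplit]; ring
  linarith
end
end
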